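/- arXiv:1202.0813 — 4 statements merged into one kernel-verified Lean document; each statement's English description precedes it below -/
import Mathlib

section
/- Let the state sequence (S_1,…,S_N) be a Markov chain on the finite state set S with transition probabilities P(s′|s) and initial state S_0 = s_0, independent of the codebook, and suppose that conditionally on the state sequence s and C_0 = x the output Y is distributed as ∏_{n=1}^N P(y_n|x_n,s_n). Then for every ρ ∈ [0,1], every final state s_N ∈ S, and M − 1 ≤ e^{NR}, the probability that a maximum-likelihood decoding failure occurs and the chain ends in state s_N, conditioned on starting at s_0, is at most ∑_{T ∈ 𝒯} exp(−N(E_{0,N}(ρ,Q,T) − ρR)) P_{T,s_N|s_0}, where 𝒯 is the set of empirical distributions (types) of length-N state sequences, E_{0,N}(ρ,Q,T) is the common value of E_{0,N}(ρ,Q,s) over sequences s of type T, and P_{T,s_N|s_0} = Pr((S_1,…,S_N) has type T and S_N = s_N | S_0 = s_0). -/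
open scoped Classical
open Finset

/-- The empirical distribution (type) of a length-`N` state sequence: for each
state `σ`, the number of indices `n` with `sq n = σ`. -/
noncomputable def typeOf {S : Type*} [Fintype S] (N : ℕ) (sq : Fin N → S) : S → ℕ :=
  fun σ => (Finset.univ.filter fun n => sq n = σ).card

/-- The probability of the trajectory `(s_1, …, s_N) = sq` of a Markov chain with
transition probabilities `Pt` started at `s0`:  `∏_{n=1}^N Pt(s_{n-1}, s_n)`. -/
noncomputable def trajProbS {S : Type*} (N : ℕ) (Pt : S → S → ℝ) (s0 : S)
    (sq : Fin N → S) : ℝ :=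
  ∏ n : Fin N,
    Pt (if h : (n : ℕ) = 0 then s0
        else sq ⟨(n : ℕ) - 1, Nat.lt_of_le_of_lt (Nat.sub_le _ _) n.isLt⟩) (sq n)

theorem sum_pi_prod_mul_apply {ι A : Type*} [Fintype ι] [DecidableEq ι] [Fintype A]
    (q : A → ℝ) (hq : ∑ a, q a = 1) (g : A → ℝ) (i : ι) :
    ∑ c : ι → A, (∏ j, q (c j)) * g (c i) = ∑ a, q a * g a := by
  have h : ∀ c : ι → A, (∏ j, q (c j)) * g (c i)
      = ∏ j, (q (c j) * if j = i then g (c j) else 1) := by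
    intro c
    rw [Finset.prod_mul_distrib, Finset.prod_ite_eq' Finset.univ i]
    simp
  simp_rw [h]
  rw [← Fintype.prod_sum (fun (j : ι) (a : A) => q a * if j = i then g a else 1),
    Finset.prod_eq_single i]
  · simp
  · intro b _ hb
    simp [hb, hq]
  · simp

/-- The union bound, raised to a power `ρ ∈ [0, 1]`, for independent draws from `q`. -/
theorem sum_pi_prod_exists_le_rpow {A : Type*} [Fintype A] (m : ℕ)
    (q : A → ℝ) (hq0 : ∀ a, 0 ≤ q a) (hq1 : ∑ a, q a = 1)
    (E : A → Prop) (ρ : ℝ) (hρ0 : 0 ≤ ρ) (hρ1 : ρ ≤ 1) :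
    ∑ c : Fin m → A, (∏ j, q (c j)) * (if ∃ i, E (c i) then 1 else 0)
      ≤ (m * ∑ a, q a * (if E a then 1 else 0)) ^ ρ := by
  set L := ∑ c : Fin m → A, (∏ j, q (c j)) * (if ∃ i, E (c i) then (1 : ℝ) else 0) with hL
  have hprod : ∀ c : Fin m → A, 0 ≤ ∏ j, q (c j) :=
    fun c => Finset.prod_nonneg fun _ _ => hq0 _
  have hL0 : 0 ≤ L := Finset.sum_nonneg fun c _ =>
    mul_nonneg (hprod c) (by split_ifs <;> norm_num)
  have hL1 : L ≤ 1 := by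
    calc L ≤ ∑ c : Fin m → A, ∏ j, q (c j) := by
          refine Finset.sum_le_sum fun c _ => mul_le_of_le_one_right (hprod c) ?_
          split_ifs <;> norm_num
      _ = 1 := by
          rw [← Fintype.prod_sum (fun (_ : Fin m) (a : A) => q a)]
          simp [hq1]
  have hunion : L ≤ m * ∑ a, q a * (if E a then 1 else 0) := by
    calc L ≤ ∑ c : Fin m → A, ∑ i, (∏ j, q (c j)) * (if E (c i) then (1 : ℝ) else 0) := by
          refine Finset.sum_le_sum fun c _ => ?_
          rw [← Finset.mul_sum]
          refine mul_le_mul_of_nonneg_left ?_ (hprod c)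
          have hnn : ∀ i ∈ Finset.univ, 0 ≤ (if E (c i) then (1 : ℝ) else 0) :=
            fun i _ => by split_ifs <;> norm_num
          split_ifs with h
          · obtain ⟨i, hi⟩ := h
            simpa [hi] using Finset.single_le_sum hnn (Finset.mem_univ i)
          · exact Finset.sum_nonneg hnn
      _ = m * ∑ a, q a * (if E a then 1 else 0) := by
          rw [Finset.sum_comm]
          refine (Finset.sum_congr rfl fun i _ =>
            sum_pi_prod_mul_apply q hq1 (fun a => if E a then (1 : ℝ) else 0) i).trans ?_
          simp
  calc L ≤ L ^ ρ := by
        rcases hL0.eq_or_lt with h | h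
        · rw [← h]; exact Real.rpow_nonneg le_rfl _
        · simpa using Real.rpow_le_rpow_of_exponent_ge h hL1 hρ1
    _ ≤ _ := Real.rpow_le_rpow hL0 hunion hρ0

/-- Gallager's bound on the decoding error contributed by a fixed channel output, where
`p a` is the likelihood of codeword `a`. -/
theorem sum_codebook_failure_le {A : Type*} [Fintype A] (m : ℕ)
    (q : A → ℝ) (hq0 : ∀ a, 0 ≤ q a) (hq1 : ∑ a, q a = 1)
    (p : A → ℝ) (hp : ∀ a, 0 ≤ p a) (ρ : ℝ) (hρ0 : 0 ≤ ρ) (hρ1 : ρ ≤ 1) :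
    ∑ c : Fin (m + 1) → A, (∏ i, q (c i)) * p (c 0) *
        (if ∃ i, i ≠ 0 ∧ p (c 0) ≤ p (c i) then 1 else 0)
      ≤ (m : ℝ) ^ ρ * (∑ a, q a * p a ^ (1 / (1 + ρ))) ^ (1 + ρ) := by
  set t := 1 / (1 + ρ) with ht
  set α := ∑ a, q a * p a ^ t with hα
  have hpos : 0 < 1 + ρ := by linarith
  have ht0 : 0 < t := by positivity
  have hα0 : 0 ≤ α := Finset.sum_nonneg fun a _ =>
    mul_nonneg (hq0 a) (Real.rpow_nonneg (hp a) _)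
  have hsplit : ∑ c : Fin (m + 1) → A, (∏ i, q (c i)) * p (c 0) *
        (if ∃ i, i ≠ 0 ∧ p (c 0) ≤ p (c i) then (1 : ℝ) else 0)
      = ∑ a, q a * (p a * ∑ c : Fin m → A, (∏ j, q (c j)) *
          (if ∃ i, p a ≤ p (c i) then 1 else 0)) := by
    rw [← (Fin.consEquiv fun _ : Fin (m + 1) => A).sum_comp, Fintype.sum_prod_type]
    refine Finset.sum_congr rfl fun a _ => ?_
    rw [Finset.mul_sum, Finset.mul_sum]
    refine Finset.sum_congr rfl fun c _ => ?_
    simp only [Fin.consEquiv_apply, Fin.prod_univ_succ, Fin.cons_zero, Fin.cons_succ,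
      Fin.exists_fin_succ, ne_eq, not_true_eq_false, false_and, false_or, Fin.succ_ne_zero,
      not_false_eq_true, true_and]
    ring
  rw [hsplit]
  calc _ ≤ ∑ a, q a * ((m : ℝ) ^ ρ * α ^ ρ * p a ^ t) := by
        refine Finset.sum_le_sum fun a _ => mul_le_mul_of_nonneg_left ?_ (hq0 a)
        rcases (hp a).eq_or_lt with h0 | h0
        · rw [← h0, zero_mul, Real.zero_rpow ht0.ne', mul_zero]
        have hu := sum_pi_prod_exists_le_rpow m q hq0 hq1 (fun b => p a ≤ p b) ρ hρ0 hρ1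
        have hmarkov : ∑ b, q b * (if p a ≤ p b then (1 : ℝ) else 0) ≤ α * p a ^ (-t) := by
          rw [hα, Finset.sum_mul]
          refine Finset.sum_le_sum fun b _ => ?_
          rw [mul_assoc]
          refine mul_le_mul_of_nonneg_left ?_ (hq0 b)
          split_ifs with h
          · rw [Real.rpow_neg h0.le, ← div_eq_mul_inv, le_div_iff₀ (Real.rpow_pos_of_pos h0 _),
              one_mul]
            exact Real.rpow_le_rpow h0.le h ht0.le
          · exact mul_nonneg (Real.rpow_nonneg (hp b) _) (Real.rpow_nonneg h0.le _)
        have hmono : ((m : ℝ) * ∑ b, q b * (if p a ≤ p b then (1 : ℝ) else 0)) ^ ρ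
            ≤ (m * (α * p a ^ (-t))) ^ ρ := by
          refine Real.rpow_le_rpow ?_ (mul_le_mul_of_nonneg_left hmarkov m.cast_nonneg) hρ0
          exact mul_nonneg m.cast_nonneg <| Finset.sum_nonneg fun b _ =>
            mul_nonneg (hq0 b) (by split_ifs <;> norm_num)
        refine (mul_le_mul_of_nonneg_left (hu.trans hmono) h0.le).trans_eq ?_
        have hexp : t = 1 + -t * ρ := by rw [ht]; field_simp; ring
        have hpt : p a ^ t = p a * (p a ^ (-t)) ^ ρ := by
          conv_lhs => rw [hexp]
          rw [Real.rpow_add h0, Real.rpow_one, Real.rpow_mul h0.le]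
        rw [hpt, Real.mul_rpow m.cast_nonneg (by positivity),
          Real.mul_rpow hα0 (by positivity)]
        ring
    _ = (m : ℝ) ^ ρ * α ^ (1 + ρ) := by
        rw [Real.rpow_add' hα0 hpos.ne', Real.rpow_one]
        conv_rhs => rw [hα]
        rw [Finset.sum_mul, Finset.mul_sum]
        exact Finset.sum_congr rfl fun a _ => by ring

theorem sum_pi_rpow_sum_pi_prod {ι X Y : Type*} [Fintype ι] [DecidableEq ι] [Fintype X] [Fintype Y]
    (Q : X → ℝ) (hQ : ∀ x, 0 ≤ Q x) (W : ι → Y → X → ℝ) (hW : ∀ n y x, 0 ≤ W n y x)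
    (t r : ℝ) :
    ∑ y : ι → Y, (∑ x : ι → X, (∏ n, Q (x n)) * (∏ n, W n (y n) (x n)) ^ t) ^ r
      = ∏ n, ∑ y, (∑ x, Q x * W n y x ^ t) ^ r := by
  rw [Fintype.prod_sum]
  refine Finset.sum_congr rfl fun y _ => ?_
  rw [Real.finsetProd_rpow _ _ fun n _ => Finset.sum_nonneg fun x _ =>
    mul_nonneg (hQ x) (Real.rpow_nonneg (hW _ _ _) _), Fintype.prod_sum]
  congr 1
  refine Finset.sum_congr rfl fun x _ => ?_
  rw [← Real.finsetProd_rpow _ _ fun n _ => hW _ _ _, Finset.prod_mul_distrib]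

theorem sum_rpow_sum_mul_rpow_pos {X Y : Type*} [Fintype X] [Fintype Y]
    (Q : X → ℝ) (hQ0 : ∀ x, 0 ≤ Q x) (hQ1 : ∑ x, Q x = 1)
    (W : Y → X → ℝ) (hW0 : ∀ y x, 0 ≤ W y x) (hW1 : ∀ x, ∑ y, W y x = 1) (t r : ℝ) :
    0 < ∑ y, (∑ x, Q x * W y x ^ t) ^ r := by
  obtain ⟨x, -, hx⟩ : ∃ x ∈ Finset.univ, 0 < Q x :=
    Finset.exists_lt_of_sum_lt (by simp [hQ1])
  obtain ⟨y, -, hy⟩ : ∃ y ∈ Finset.univ, 0 < W y x :=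
    Finset.exists_lt_of_sum_lt (by simp [hW1])
  have hterm : ∀ y x, 0 ≤ Q x * W y x ^ t :=
    fun y x => mul_nonneg (hQ0 x) (Real.rpow_nonneg (hW0 y x) _)
  refine Finset.sum_pos' (fun y _ => Real.rpow_nonneg (Finset.sum_nonneg fun x _ => hterm y x) _)
    ⟨y, Finset.mem_univ _, Real.rpow_pos_of_pos ?_ _⟩
  exact Finset.sum_pos' (fun x _ => hterm y x)
    ⟨x, Finset.mem_univ _, mul_pos hx (Real.rpow_pos_of_pos hy _)⟩

theorem prod_pow_typeOf {S : Type*} [Fintype S] (N : ℕ) (F : S → ℝ) (sq : Fin N → S) :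
    ∏ σ, F σ ^ typeOf N sq σ = ∏ n, F (sq n) := by
  rw [← Finset.prod_fiberwise Finset.univ sq]
  refine Finset.prod_congr rfl fun σ _ => ?_
  rw [typeOf, ← Finset.prod_const]
  exact Finset.prod_congr rfl fun n hn => by rw [(Finset.mem_filter.mp hn).2]

/-- for a Markov state sequence started at `s0` and independent of the
codebook, the probability that maximum-likelihood decoding fails *and* the chain ends
in state `sN` is bounded by `∑_{T} exp(−N(E_{0,N}(ρ,Q,T) − ρR)) · P_{T,s_N|s_0}`,
where the sum ranges over all empirical distributions (types) `T` of length-`N`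
state sequences, `E_{0,N}(ρ,Q,T)` is the common value of `E_{0,N}(ρ,Q,s)` over
sequences of type `T`, and `P_{T,s_N|s_0}` is the probability that the chain has
type `T` and ends at `sN`. -/
theorem stmt_2 {X Y S : Type*} [Fintype X] [Fintype Y] [Fintype S]
    (N M : ℕ) (hN : 1 ≤ N) (hM : 2 ≤ M)
    (Q : X → ℝ) (hQ0 : ∀ x, 0 ≤ Q x) (hQ1 : ∑ x, Q x = 1)
    (P : Y → X → S → ℝ) (hP0 : ∀ y x s, 0 ≤ P y x s)
    (hP1 : ∀ x s, ∑ y, P y x s = 1)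
    (Pt : S → S → ℝ) (hPt0 : ∀ s s', 0 ≤ Pt s s') (hPt1 : ∀ s, ∑ s', Pt s s' = 1)
    (s0 sN : S) (ρ R : ℝ) (hρ0 : 0 ≤ ρ) (hρ1 : ρ ≤ 1)
    (hMR : (M : ℝ) - 1 ≤ Real.exp (N * R)) :
    (∑ sq : Fin N → S, trajProbS N Pt s0 sq *
        (if sq ⟨N - 1, by omega⟩ = sN then 1 else 0) *
        ∑ cb : Fin M → Fin N → X, ∑ y : Fin N → Y,
          (∏ i, ∏ n, Q (cb i n)) * (∏ n, P (y n) (cb ⟨0, by omega⟩ n) (sq n)) *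
            (if ∃ i : Fin M, i ≠ ⟨0, by omega⟩ ∧
                (∏ n, P (y n) (cb ⟨0, by omega⟩ n) (sq n)) ≤ ∏ n, P (y n) (cb i n) (sq n)
              then 1 else 0))
      ≤ ∑ T ∈ Finset.image (typeOf N) (Finset.univ : Finset (Fin N → S)),
          Real.exp (-(N : ℝ) *
            ((-(1 / (N : ℝ)) * Real.log (∏ σ : S, (∑ y : Y,
                (∑ x : X, Q x * P y x σ ^ (1 / (1 + ρ))) ^ (1 + ρ)) ^ (T σ))) - ρ * R)) *
          ∑ sq : Fin N → S,
            (if typeOf N sq = T ∧ sq ⟨N - 1, by omega⟩ = sN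
              then trajProbS N Pt s0 sq else 0) := by
  obtain ⟨m, rfl⟩ : ∃ m, M = m + 1 := ⟨M - 1, by omega⟩
  set F : S → ℝ := fun σ => ∑ y, (∑ x, Q x * P y x σ ^ (1 / (1 + ρ))) ^ (1 + ρ) with hF
  have hFpos : ∀ σ, 0 < F σ := fun σ =>
    sum_rpow_sum_mul_rpow_pos Q hQ0 hQ1 (fun y x => P y x σ) (fun y x => hP0 y x σ)
      (fun x => hP1 x σ) _ _
  have hexp : ∀ T : S → ℕ, Real.exp (-(N : ℝ) *
      ((-(1 / (N : ℝ)) * Real.log (∏ σ, F σ ^ T σ)) - ρ * R))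
        = Real.exp (N * R) ^ ρ * ∏ σ, F σ ^ T σ := by
    intro T
    have hN0 : (N : ℝ) ≠ 0 := by positivity
    have hprod : 0 < ∏ σ, F σ ^ T σ := Finset.prod_pos fun σ _ => pow_pos (hFpos σ) _
    conv_rhs => rw [← Real.exp_log hprod]
    rw [← Real.exp_mul, ← Real.exp_add]
    congr 1
    field_simp
    ring
  have hfail : ∀ sq : Fin N → S,
      (∑ cb : Fin (m + 1) → Fin N → X, ∑ y : Fin N → Y,
          (∏ i, ∏ n, Q (cb i n)) * (∏ n, P (y n) (cb ⟨0, by omega⟩ n) (sq n)) *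
            (if ∃ i : Fin (m + 1), i ≠ ⟨0, by omega⟩ ∧
                (∏ n, P (y n) (cb ⟨0, by omega⟩ n) (sq n)) ≤ ∏ n, P (y n) (cb i n) (sq n)
              then (1 : ℝ) else 0))
        ≤ Real.exp (N * R) ^ ρ * ∏ σ, F σ ^ typeOf N sq σ := by
    intro sq
    rw [Finset.sum_comm, prod_pow_typeOf, hF,
      ← sum_pi_rpow_sum_pi_prod Q hQ0 (fun n y x => P y x (sq n)) (fun n y x => hP0 y x (sq n)),
      Finset.mul_sum]
    refine Finset.sum_le_sum fun y _ => ?_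
    refine (sum_codebook_failure_le m (fun x : Fin N → X => ∏ n, Q (x n))
      (fun x => Finset.prod_nonneg fun n _ => hQ0 _)
      (by rw [← Fintype.prod_sum (fun (_ : Fin N) (x : X) => Q x)]; simp [hQ1])
      (fun x => ∏ n, P (y n) (x n) (sq n))
      (fun x => Finset.prod_nonneg fun n _ => hP0 _ _ _) ρ hρ0 hρ1).trans ?_
    refine mul_le_mul_of_nonneg_right
      (Real.rpow_le_rpow m.cast_nonneg (by simpa using hMR) hρ0) ?_
    exact Real.rpow_nonneg (Finset.sum_nonneg fun x _ =>
      mul_nonneg (Finset.prod_nonneg fun n _ => hQ0 _)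
        (Real.rpow_nonneg (Finset.prod_nonneg fun n _ => hP0 _ _ _) _)) _
  have htraj : ∀ sq, 0 ≤ trajProbS N Pt s0 sq := fun sq =>
    Finset.prod_nonneg fun n _ => hPt0 _ _
  change _ ≤ ∑ T ∈ _, Real.exp (-(N : ℝ) *
    ((-(1 / (N : ℝ)) * Real.log (∏ σ, F σ ^ T σ)) - ρ * R)) * ∑ sq : Fin N → S,
      (if typeOf N sq = T ∧ sq ⟨N - 1, by omega⟩ = sN then trajProbS N Pt s0 sq else 0)
  simp_rw [hexp, Finset.mul_sum (Finset.univ : Finset (Fin N → S))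
    (fun sq => if _ ∧ _ then trajProbS N Pt s0 sq else 0)]
  rw [Finset.sum_comm]
  refine Finset.sum_le_sum fun sq _ => ?_
  rw [Finset.sum_eq_single_of_mem (typeOf N sq)
    (Finset.mem_image_of_mem _ (Finset.mem_univ _))
    (fun T _ hT => by rw [if_neg fun h => hT h.1.symm, mul_zero])]
  by_cases hs : sq ⟨N - 1, by omega⟩ = sN
  · simp only [hs, if_true, and_self, mul_one]
    rw [mul_comm (_ * _) (trajProbS N Pt s0 sq)]
    exact mul_le_mul_of_nonneg_left (hfail sq) (htraj sq)
  · simp [hs]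
end

section
/- For every integer m with 0 < m < N: (i) Pr(n_g = m, s_N = g | s_0 = b) = (1−α)^{m+1} (1−β)^{N−m−1} (β/(1−α)) F(−N+m+1,−m;1;λ), and (ii) Pr(n_g = m, s_N = b | s_0 = b) = (1−α)^m (1−β)^{N−m} [F(−N+m,−m;1;λ) − F(−N+m,−m+1;1;λ)]. Moreover, Pr(n_g = N, s_N = d | s_0 = b) = 0 for d ∈ {g,b}, and Pr(n_g = 0, s_N = b | s_0 = b) = (1−β)^N. -/
open scoped Classical
open Finset

/-- One step of the two-state Gilbert-Elliott Markov chain on `Bool`, where `true`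
is the good state `g` and `false` is the bad state `b`:
`P(b|g) = a`, `P(g|g) = 1−a`, `P(g|b) = b`, `P(b|b) = 1−b`. -/
noncomputable def geStep (a b : ℝ) (c d : Bool) : ℝ :=
  if c then (if d then 1 - a else a) else (if d then b else 1 - b)

/-- Probability of the trajectory `(t 0, t 1, …, t N)` given its initial state:
`∏_{n=0}^{N-1} P(t (n+1) | t n)`. -/
noncomputable def geTrajProb (a b : ℝ) (N : ℕ) (t : Fin (N + 1) → Bool) : ℝ :=
  ∏ n : Fin N, geStep a b (t n.castSucc) (t n.succ)

/-- `Pr(n_g = m, s_N = d | s_0 = c)`: the sum of trajectory probabilities over all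
trajectories `(s_0, …, s_N)` with `s_0 = c`, `s_N = d`, and exactly `m` indices
`n ∈ {0, …, N−1}` with `s_n = g` (`g = true`). -/
noncomputable def prOcc (a b : ℝ) (N m : ℕ) (c d : Bool) : ℝ :=
  ∑ t : Fin (N + 1) → Bool,
    if t 0 = c ∧ t (Fin.last N) = d ∧
        (Finset.univ.filter fun n : Fin N => t n.castSucc = true).card = m
      then geTrajProb a b N t else 0

/-- The terminating Gauss hypergeometric series
`F(−a, −b; 1; λ) = ∑_{k ≥ 0} C(a,k) C(b,k) λ^k`. -/
noncomputable def hypF (a b : ℕ) (l : ℝ) : ℝ :=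
  ∑ k ∈ Finset.range (a + 1), (a.choose k : ℝ) * (b.choose k : ℝ) * l ^ k

/-- Separating the last step of the trajectories of length `N + 1`. -/
theorem prOcc_succ_eq_sum (a b : ℝ) (N m : ℕ) (c d : Bool) :
    prOcc a b (N + 1) m c d = ∑ t : Fin (N + 1) → Bool,
      if t 0 = c ∧ (Finset.univ.filter fun n : Fin N => t n.castSucc = true).card +
          (if t (Fin.last N) = true then 1 else 0) = m
        then geTrajProb a b N t * geStep a b (t (Fin.last N)) d else 0 := by
  unfold prOcc
  rw [← (Fin.snocEquiv fun _ : Fin (N + 2) => Bool).sum_comp, Fintype.sum_prod_type,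
    Finset.sum_eq_single d]
  · refine Finset.sum_congr rfl fun t _ => ?_
    have h0 : (Fin.snoc t d : Fin (N + 2) → Bool) 0 = t 0 :=
      Fin.snoc_castSucc (α := fun _ => Bool) d t 0
    have hs (n : Fin N) : (Fin.snoc t d : Fin (N + 2) → Bool) n.castSucc.succ = t n.succ := by
      rw [Fin.succ_castSucc]
      exact Fin.snoc_castSucc (α := fun _ => Bool) d t n.succ
    simp only [Fin.snocEquiv_apply, h0, Fin.snoc_last, true_and, Finset.card_filter, geTrajProb,
      Fin.sum_univ_castSucc, Fin.prod_univ_castSucc, Fin.snoc_castSucc, hs, Fin.succ_last]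
  · intro e _ he
    refine Finset.sum_eq_zero fun t _ => if_neg ?_
    simp [Fin.snocEquiv_apply, he]
  · simp

theorem prOcc_succ_succ (a b : ℝ) (N m : ℕ) (c d : Bool) :
    prOcc a b (N + 1) (m + 1) c d =
      prOcc a b N m c true * geStep a b true d +
        prOcc a b N (m + 1) c false * geStep a b false d := by
  rw [prOcc_succ_eq_sum]
  unfold prOcc
  rw [Finset.sum_mul, Finset.sum_mul, ← Finset.sum_add_distrib]
  refine Finset.sum_congr rfl fun t _ => ?_
  cases t (Fin.last N) <;> simp

theorem prOcc_succ_zero (a b : ℝ) (N : ℕ) (c d : Bool) :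
    prOcc a b (N + 1) 0 c d = prOcc a b N 0 c false * geStep a b false d := by
  rw [prOcc_succ_eq_sum]
  unfold prOcc
  rw [Finset.sum_mul]
  refine Finset.sum_congr rfl fun t _ => ?_
  cases t (Fin.last N) <;> simp

theorem prOcc_zero (a b : ℝ) (m : ℕ) (c d : Bool) :
    prOcc a b 0 m c d = if c = d ∧ m = 0 then 1 else 0 := by
  unfold prOcc
  rw [← (Equiv.funUnique (Fin 1) Bool).symm.sum_comp]
  cases c <;> cases d <;> simp [geTrajProb, eq_comm (a := 0), -Finset.sum_boole]

/-- Starting in the bad state, the chain cannot occupy the good state at every time. -/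
theorem prOcc_false_eq_zero (a b : ℝ) (N : ℕ) :
    (∀ m, N ≤ m → prOcc a b N m false true = 0) ∧
      ∀ m, N ≤ m + 1 → prOcc a b N (m + 1) false false = 0 := by
  induction N with
  | zero => simp [prOcc_zero]
  | succ N ih =>
    obtain ⟨ihg, ihb⟩ := ih
    refine ⟨fun m hm => ?_, fun m hm => ?_⟩
    · obtain ⟨m, rfl⟩ : ∃ k, m = k + 1 := ⟨m - 1, by omega⟩
      rw [prOcc_succ_succ, ihg m (by omega), ihb m (by omega)]
      simp
    · rw [prOcc_succ_succ, ihg m (by omega), ihb m (by omega)]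
      simp

theorem hypF_eq_sum_range {a n : ℕ} (h : a < n) (b : ℕ) (l : ℝ) :
    hypF a b l = ∑ k ∈ Finset.range n, (a.choose k : ℝ) * (b.choose k : ℝ) * l ^ k := by
  refine Finset.sum_subset (Finset.range_mono h) fun k _ hk => ?_
  rw [Nat.choose_eq_zero_of_lt (by simpa using hk)]
  simp

theorem hypF_zero_left (b : ℕ) (l : ℝ) : hypF 0 b l = 1 := by
  simp [hypF]

theorem hypF_zero_right (a : ℕ) (l : ℝ) : hypF a 0 l = 1 := by
  simp [hypF, Finset.sum_range_succ']

/-- Pascal's rule in both parameters of the hypergeometric series. -/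
theorem hypF_succ_succ (a b : ℕ) (l : ℝ) :
    hypF (a + 1) (b + 1) l - hypF (a + 1) b l =
      hypF a (b + 1) l - hypF a b l + l * hypF a b l := by
  have h (c : ℕ) := hypF_eq_sum_range (show a < a + 1 + 1 by omega) c l
  have hm : l * hypF a b l =
      ∑ k ∈ Finset.range (a + 1), l * ((a.choose k : ℝ) * (b.choose k : ℝ) * l ^ k) := by
    rw [hypF, Finset.mul_sum]
  rw [hm, h (b + 1), h b]
  simp only [hypF, Finset.sum_range_succ' _ (a + 1), Nat.choose_zero_right,
    add_sub_add_right_eq_sub, ← Finset.sum_sub_distrib, ← Finset.sum_add_distrib]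
  refine Finset.sum_congr rfl fun k _ => ?_
  push_cast [Nat.choose_succ_succ']
  ring

theorem prOcc_false_closed_form {a b : ℝ} (ha : 1 - a ≠ 0) (hb : 1 - b ≠ 0) (N : ℕ) :
    (∀ p m, p + m + 1 = N → prOcc a b N m false true =
        b * (1 - a) ^ m * (1 - b) ^ p * hypF p m (a * b / ((1 - a) * (1 - b)))) ∧
      (∀ p m, p + m + 1 = N → prOcc a b N (m + 1) false false =
        (1 - a) ^ (m + 1) * (1 - b) ^ p *
          (hypF p (m + 1) (a * b / ((1 - a) * (1 - b))) -
            hypF p m (a * b / ((1 - a) * (1 - b))))) ∧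
      prOcc a b N 0 false false = (1 - b) ^ N := by
  have hl : a * b / ((1 - a) * (1 - b)) * ((1 - a) * (1 - b)) = a * b := by field_simp
  generalize a * b / ((1 - a) * (1 - b)) = l at hl ⊢
  induction N with
  | zero => simp [prOcc_zero]
  | succ N ih =>
    obtain ⟨ihg, ihb, ih0⟩ := ih
    refine ⟨fun p m h => ?_, fun p m h => ?_, ?_⟩
    · cases m with
      | zero =>
        obtain rfl : p = N := by omega
        rw [prOcc_succ_zero, ih0, hypF_zero_right]
        simp [geStep, mul_comm]
      | succ m =>
        rw [prOcc_succ_succ, ihg p m (by omega), ihb p m (by omega)]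
        simp only [geStep, if_true, Bool.false_eq_true, if_false]
        ring
    · cases p with
      | zero =>
        obtain ⟨hg, hf⟩ := prOcc_false_eq_zero a b N
        rw [prOcc_succ_succ, hg m (by omega), hf m (by omega)]
        simp [hypF_zero_left]
      | succ p =>
        rw [prOcc_succ_succ, ihg p m (by omega), ihb p m (by omega), hypF_succ_succ]
        simp only [geStep, if_true, Bool.false_eq_true, if_false]
        linear_combination -(1 - a) ^ m * (1 - b) ^ p * hypF p m l * hl
    · rw [prOcc_succ_zero, ih0, pow_succ]
      simp [geStep]

/-- joint distribution of the good-state occupation time `n_g` and the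
final state, conditioned on starting in the bad state `b`, for the two-state
Gilbert-Elliott Markov chain, in terms of hypergeometric functions, with
`λ = αβ/((1−α)(1−β))`. -/
theorem stmt_4 (N : ℕ) (hN : 1 ≤ N) (α β : ℝ)
    (hα : α ∈ Set.Ioo (0 : ℝ) 1) (hβ : β ∈ Set.Ioo (0 : ℝ) 1) :
    (∀ m : ℕ, 0 < m → m < N →
      prOcc α β N m false true =
        (1 - α) ^ (m + 1) * (1 - β) ^ (N - m - 1) * (β / (1 - α)) *
          hypF (N - m - 1) m (α * β / ((1 - α) * (1 - β))) ∧
      prOcc α β N m false false =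
        (1 - α) ^ m * (1 - β) ^ (N - m) *
          (hypF (N - m) m (α * β / ((1 - α) * (1 - β))) -
            hypF (N - m) (m - 1) (α * β / ((1 - α) * (1 - β))))) ∧
    (∀ d : Bool, prOcc α β N N false d = 0) ∧
    prOcc α β N 0 false false = (1 - β) ^ N := by
  have hα' : 1 - α ≠ 0 := (sub_pos.mpr hα.2).ne'
  have hβ' : 1 - β ≠ 0 := (sub_pos.mpr hβ.2).ne'
  obtain ⟨hg, hb, h0⟩ := prOcc_false_closed_form hα' hβ' N
  obtain ⟨hg0, hb0⟩ := prOcc_false_eq_zero α β N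
  refine ⟨fun m hm hmN => ⟨?_, ?_⟩, fun d => ?_, h0⟩
  · rw [hg (N - m - 1) m (by omega)]
    field_simp
    ring
  · obtain ⟨m, rfl⟩ : ∃ k, m = k + 1 := ⟨m - 1, by omega⟩
    exact hb (N - (m + 1)) m (by omega)
  · cases d
    · obtain ⟨n, rfl⟩ : ∃ n, N = n + 1 := ⟨N - 1, by omega⟩
      exact hb0 n le_rfl
    · exact hg0 N le_rfl
end

section
/- Let α, β > 0 and let x ∈ (0,1). For each N > max(α,β), consider the two-state Markov chain with transition probabilities α_N = α/N and β_N = β/N, and let Pr_N(n_g = m, s_N = d | s_0 = c) denote the corresponding occupancy probabilities. If (m_N) is a sequence of integers with 0 ≤ m_N ≤ N and m_N/N → x, then lim_{N→∞} N · Pr_N(n_g = m_N, s_N = b | s_0 = g) = α e^{−αx−β(1−x)} ∑_{k=0}^∞ (αβ x(1−x))^k / (k!)^2 (the series equals I_0(2√(αβx(1−x))), the modified Bessel function of order 0). -/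
open scoped Classical
open Finset Filter

theorem prOcc_succ (a b : ℝ) (N m : ℕ) (c d : Bool) :
    prOcc a b (N + 1) (m + c.toNat) c d = ∑ e, geStep a b c e * prOcc a b N m e d := by
  have hcard (x : Bool) (t : Fin (N + 1) → Bool) :
      (univ.filter fun n : Fin (N + 1) =>
        (Fin.cons x t : Fin (N + 2) → Bool) n.castSucc = true).card =
      (univ.filter fun n : Fin N => t n.castSucc = true).card + x.toNat := by
    rw [Fin.card_filter_univ_succ]
    cases x <;> simp
  simp only [prOcc, mul_sum]
  rw [sum_comm, ← (Fin.consEquiv fun _ : Fin (N + 2) => Bool).sum_comp, Fintype.sum_prod_type,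
    sum_comm]
  refine sum_congr rfl fun t _ => ?_
  simp only [Fin.consEquiv, Equiv.coe_fn_mk, ← Fin.succ_last, Fin.cons_succ, Fin.cons_zero]
  rw [sum_eq_single c (by simp +contextual) (by simp),
    sum_eq_single (t 0) (fun e _ he => by simp [he.symm]) (by simp)]
  simp only [geTrajProb, Fin.prod_univ_succ, true_and, mul_ite, mul_zero]
  exact if_congr (and_congr_right fun _ => (Eq.congr_left (hcard c t)).trans
    Nat.add_right_cancel_iff) rfl rfl

theorem prOcc_eq_zero_of_lt (a b : ℝ) {N m : ℕ} (h : N < m) (c d : Bool) :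
    prOcc a b N m c d = 0 := by
  refine sum_eq_zero fun t _ => if_neg ?_
  rintro ⟨-, -, hm⟩
  have := card_filter_le (univ : Finset (Fin N)) fun n => t n.castSucc = true
  simp only [card_univ, Fintype.card_fin] at this
  omega

theorem prOcc_zero_right_true_false (a b : ℝ) (N : ℕ) : prOcc a b N 0 true false = 0 := by
  refine sum_eq_zero fun t _ => if_neg ?_
  rintro ⟨h0, h1, hm⟩
  cases N with
  | zero => simp_all
  | succ N =>
    rw [card_eq_zero, filter_eq_empty_iff] at hm
    exact hm (mem_univ 0) h0

theorem prOcc_zero_false_false (a b : ℝ) : prOcc a b 0 0 false false = 1 := by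
  rw [prOcc, sum_eq_single (fun _ => false)]
  · simp [geTrajProb]
  · intro t _ ht
    refine if_neg fun h => ht ?_
    ext i
    rw [Fin.fin_one_eq_zero i, h.1]
  · simp

/-- The coefficient of `X ^ k` in `(X + p) ^ n`. -/
noncomputable def binomCoeff (p : ℝ) (n k : ℕ) : ℝ := n.choose k * p ^ (n - k)

theorem binomCoeff_zero_right (p : ℝ) (n : ℕ) : binomCoeff p n 0 = p ^ n := by
  simp [binomCoeff]

theorem binomCoeff_eq_zero_of_lt (p : ℝ) {n k : ℕ} (h : n < k) : binomCoeff p n k = 0 := by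
  simp [binomCoeff, Nat.choose_eq_zero_of_lt h]

theorem binomCoeff_succ_succ (p : ℝ) (n k : ℕ) :
    binomCoeff p (n + 1) (k + 1) = binomCoeff p n k + p * binomCoeff p n (k + 1) := by
  rcases lt_or_ge n (k + 1) with h | h
  · rw [binomCoeff_eq_zero_of_lt p h]
    simp [binomCoeff, Nat.choose_succ_succ, Nat.choose_eq_zero_of_lt h]
  · obtain ⟨r, rfl⟩ := Nat.exists_eq_add_of_le h
    have h1 : k + 1 + r + 1 - (k + 1) = r + 1 := by omega
    have h2 : k + 1 + r - k = r + 1 := by omega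
    have h3 : k + 1 + r - (k + 1) = r := by omega
    simp only [binomCoeff, Nat.choose_succ_succ (k + 1 + r) k, h1, h2, h3]
    push_cast
    ring

theorem prOcc_zero_right_false_false (a b : ℝ) (N : ℕ) :
    prOcc a b N 0 false false = (1 - b) ^ N := by
  induction N with
  | zero => simpa using prOcc_zero_false_false a b
  | succ N ih =>
    have := prOcc_succ a b N 0 false false
    simp only [Bool.toNat_false, add_zero, Fintype.sum_bool, prOcc_zero_right_true_false,
      ih] at this
    rw [this]
    simp [geStep, pow_succ']

/-- With `m + 1` steps out of `g` and `j` steps out of `b`, trajectories ending in `b` are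
classified by the number `k` of transitions `b → g` (after the initial one, when starting
from `b`). -/
theorem prOcc_eq_sum (a b : ℝ) (N : ℕ) : ∀ m j K : ℕ, m + 1 + j = N → m < K →
    prOcc a b N (m + 1) true false =
      a * ∑ k ∈ range K, binomCoeff (1 - a) m k * binomCoeff (1 - b) j k * (a * b) ^ k ∧
    prOcc a b N (m + 1) false false =
      ∑ k ∈ range K, binomCoeff (1 - a) m k * binomCoeff (1 - b) j (k + 1) * (a * b) ^ (k + 1) := by
  induction N with
  | zero => intro m j K h; omega
  | succ N ih =>
    intro m j K hN hK
    have hg := prOcc_succ a b N m true false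
    have hb := prOcc_succ a b N (m + 1) false false
    simp only [Bool.toNat_true, Bool.toNat_false, add_zero, Fintype.sum_bool] at hg hb
    rw [hg, hb]
    constructor
    · cases m with
      | zero =>
        obtain rfl : N = j := by omega
        rw [prOcc_zero_right_true_false, prOcc_zero_right_false_false, sum_eq_single 0]
        · simp [geStep, binomCoeff]
        · intro k _ hk
          simp [binomCoeff_eq_zero_of_lt _ (Nat.pos_of_ne_zero hk)]
        · simp; omega
      | succ m =>
        obtain ⟨K, rfl⟩ : ∃ L, K = L + 1 := ⟨K - 1, by omega⟩
        rw [(ih m j (K + 1) (by omega) (by omega)).1, (ih m j K (by omega) (by omega)).2,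
          sum_range_succ', sum_range_succ' (fun k => binomCoeff (1 - a) (m + 1) k * _ * _)]
        simp only [binomCoeff_succ_succ, binomCoeff_zero_right, add_mul, sum_add_distrib,
          mul_assoc, ← mul_sum]
        simp only [geStep, pow_zero, if_true, Bool.false_eq_true, if_false]
        ring
    · cases j with
      | zero =>
        rw [prOcc_eq_zero_of_lt a b (by omega), prOcc_eq_zero_of_lt a b (by omega)]
        simp [binomCoeff_eq_zero_of_lt]
      | succ j =>
        rw [(ih m j K (by omega) hK).1, (ih m j K (by omega) hK).2]
        simp only [geStep, binomCoeff_succ_succ, if_true, Bool.false_eq_true, if_false, mul_sum,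
          ← sum_add_distrib]
        refine sum_congr rfl fun k _ => ?_
        ring

theorem binomCoeff_nonneg {p : ℝ} (hp : 0 ≤ p) (n k : ℕ) : 0 ≤ binomCoeff p n k := by
  unfold binomCoeff
  positivity

theorem binomCoeff_le {p : ℝ} (hp : 0 ≤ p) (hp1 : p ≤ 1) {n N : ℕ} (h : n ≤ N) (k : ℕ) :
    binomCoeff p n k ≤ (N : ℝ) ^ k / k.factorial := by
  calc binomCoeff p n k ≤ n.choose k * 1 :=
        mul_le_mul_of_nonneg_left (pow_le_one₀ hp hp1) (by positivity)
    _ ≤ (n : ℝ) ^ k / k.factorial := by simpa using Nat.choose_le_pow_div k n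
    _ ≤ (N : ℝ) ^ k / k.factorial := by gcongr

theorem tendsto_binomCoeff_div_pow (c y : ℝ) (hy : 0 < y) (n : ℕ → ℕ)
    (hn : Tendsto (fun N : ℕ => (n N : ℝ) / N) atTop (nhds y)) (k : ℕ) :
    Tendsto (fun N : ℕ => binomCoeff (1 - c / N) (n N) k / (N : ℝ) ^ k) atTop
      (nhds (y ^ k / k.factorial * Real.exp (-(c * y)))) := by
  have hn_top : Tendsto n atTop atTop := by
    rw [← tendsto_natCast_atTop_iff (R := ℝ)]
    refine (hn.pos_mul_atTop hy (tendsto_natCast_atTop_atTop (R := ℝ))).congr' ?_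
    filter_upwards [eventually_ne_atTop 0] with N hN
    field_simp
  have hchoose : Tendsto (fun N : ℕ => ((n N).choose k : ℝ) / (N : ℝ) ^ k) atTop
      (nhds (y ^ k / k.factorial)) := by
    have h := ((isEquivalent_choose k).comp_tendsto hn_top).mul
      (Asymptotics.IsEquivalent.refl (u := fun N : ℕ => ((N : ℝ) ^ k)⁻¹))
    refine (h.symm.tendsto_nhds ((hn.pow k).div_const (k.factorial : ℝ) |>.congr fun N => ?_)).congr
      fun N => ?_
    · simp only [Function.comp, Pi.mul_apply, div_pow]
      ring
    · simp [Function.comp, div_eq_mul_inv]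
  have hbase : Tendsto (fun N : ℕ => (1 - c / N) ^ N) atTop (nhds (Real.exp (-c))) :=
    (Real.tendsto_one_add_div_pow_exp (-c)).congr fun N => by rw [neg_div, sub_eq_add_neg]
  have hexp : Tendsto (fun N : ℕ => ((n N - k : ℕ) : ℝ) / N) atTop (nhds y) := by
    have h := hn.sub (tendsto_const_div_atTop_nhds_zero_nat (k : ℝ))
    rw [sub_zero] at h
    refine h.congr' ?_
    filter_upwards [hn_top.eventually_ge_atTop k] with N hN
    rw [Nat.cast_sub hN, sub_div]
  have hpow : Tendsto (fun N : ℕ => (1 - c / N) ^ (n N - k)) atTop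
      (nhds (Real.exp (-(c * y)))) := by
    have h := hbase.rpow hexp (Or.inl (Real.exp_pos _).ne')
    rw [← Real.exp_mul, neg_mul] at h
    have hpos : ∀ᶠ N : ℕ in atTop, 0 < 1 - c / N := by
      have := (tendsto_const_nhds (x := (1 : ℝ))).sub (tendsto_const_div_atTop_nhds_zero_nat c)
      rw [sub_zero] at this
      exact this.eventually_const_lt one_pos
    refine h.congr' ?_
    filter_upwards [hpos, eventually_ne_atTop 0] with N hN hN0
    rw [← Real.rpow_natCast _ N, ← Real.rpow_mul hN.le, ← Real.rpow_natCast]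
    congr 1
    field_simp
  exact (hchoose.mul hpow).congr fun N => by rw [binomCoeff]; ring

theorem summable_pow_div_factorial_sq (u : ℝ) (hu : 0 ≤ u) :
    Summable fun k : ℕ => u ^ k / (k.factorial : ℝ) ^ 2 := by
  refine (Real.summable_pow_div_factorial u).of_nonneg_of_le (fun k => by positivity) fun k => ?_
  have : (1 : ℝ) ≤ k.factorial := mod_cast k.factorial_pos
  gcongr
  nlinarith

theorem prOcc_eq_tsum (a b : ℝ) {N m : ℕ} (h : m + 1 ≤ N) :
    prOcc a b N (m + 1) true false = a * ∑' k,
      binomCoeff (1 - a) m k * binomCoeff (1 - b) (N - (m + 1)) k * (a * b) ^ k := by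
  rw [(prOcc_eq_sum a b N m (N - (m + 1)) (m + 1) (by omega) (by omega)).1, tsum_eq_sum]
  intro k hk
  rw [binomCoeff_eq_zero_of_lt _ (by simpa using hk), zero_mul, zero_mul]

/-- in the rare-transition regime (transition probabilities `α/N`, `β/N`),
if `m_N/N → x ∈ (0,1)` then
`N · Pr_N(n_g = m_N, s_N = b | s_0 = g) → α e^{−αx−β(1−x)} I_0(2√(αβx(1−x)))`,
where `I_0(2√u) = ∑_k u^k/(k!)²` is the modified Bessel function of order 0. -/
theorem stmt_7 (α β x : ℝ) (hα : 0 < α) (hβ : 0 < β) (hx : x ∈ Set.Ioo (0 : ℝ) 1)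
    (m : ℕ → ℕ) (hm : ∀ N, m N ≤ N)
    (hmx : Tendsto (fun N : ℕ => (m N : ℝ) / N) atTop (nhds x)) :
    Tendsto (fun N : ℕ => (N : ℝ) * prOcc (α / N) (β / N) N (m N) true false) atTop
      (nhds (α * Real.exp (-(α * x) - β * (1 - x)) *
        ∑' k : ℕ, (α * β * x * (1 - x)) ^ k / (k.factorial : ℝ) ^ 2)) := by
  obtain ⟨hx0, hx1⟩ := hx
  have hm_pos : ∀ᶠ N in atTop, 1 ≤ m N := by
    filter_upwards [hmx.eventually_const_lt hx0] with N hN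
    rw [Nat.one_le_iff_ne_zero]
    intro h
    simp [h] at hN
  have hmx' : Tendsto (fun N : ℕ => ((m N - 1 : ℕ) : ℝ) / N) atTop (nhds x) := by
    have h := hmx.sub (tendsto_const_div_atTop_nhds_zero_nat (1 : ℝ))
    rw [sub_zero] at h
    refine h.congr' ?_
    filter_upwards [hm_pos] with N hN
    rw [Nat.cast_sub hN, sub_div, Nat.cast_one]
  have hjx : Tendsto (fun N : ℕ => ((N - m N : ℕ) : ℝ) / N) atTop (nhds (1 - x)) := by
    refine (hmx.const_sub 1).congr' ?_
    filter_upwards [eventually_ne_atTop 0] with N hN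
    rw [Nat.cast_sub (hm N), sub_div, div_self (by positivity)]
  have hp (c : ℝ) (hc : 0 < c) : ∀ᶠ N : ℕ in atTop, 0 ≤ 1 - c / N ∧ 1 - c / N ≤ 1 := by
    filter_upwards [(tendsto_const_div_atTop_nhds_zero_nat c).eventually_lt_const one_pos]
      with N hN
    have : 0 ≤ c / N := by positivity
    constructor <;> linarith
  have hlim := tendsto_tsum_of_dominated_convergence (𝓕 := atTop)
    (f := fun (N k : ℕ) => binomCoeff (1 - α / N) (m N - 1) k / (N : ℝ) ^ k *
      (binomCoeff (1 - β / N) (N - m N) k / (N : ℝ) ^ k) * (α * β) ^ k)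
    (summable_pow_div_factorial_sq (α * β) (by positivity))
    (fun k => ((tendsto_binomCoeff_div_pow α x hx0 _ hmx' k).mul
      (tendsto_binomCoeff_div_pow β (1 - x) (by linarith) _ hjx k)).mul_const _) ?_
  · have h := hlim.const_mul α
    have hval : α * Real.exp (-(α * x) - β * (1 - x)) *
          ∑' k : ℕ, (α * β * x * (1 - x)) ^ k / (k.factorial : ℝ) ^ 2 =
        α * ∑' k : ℕ, x ^ k / k.factorial * Real.exp (-(α * x)) *
          ((1 - x) ^ k / k.factorial * Real.exp (-(β * (1 - x)))) * (α * β) ^ k := by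
      rw [mul_assoc, ← tsum_mul_left]
      congr 2 with k
      rw [sub_eq_add_neg, Real.exp_add, mul_pow (α * β * x), mul_pow (α * β)]
      ring
    rw [hval]
    refine h.congr' ?_
    filter_upwards [hm_pos, eventually_ne_atTop 0] with N hN hN0
    obtain ⟨M, hM⟩ := Nat.exists_eq_add_of_le' hN
    have hMN := hm N
    rw [hM] at hMN ⊢
    rw [prOcc_eq_tsum _ _ hMN, ← mul_assoc, mul_div_cancel₀ _ (by positivity),
      Nat.add_sub_cancel]
    congr 2 with k
    rw [div_mul_div_comm, div_mul_div_comm, div_pow, mul_pow (N : ℝ)]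
    ring
  · filter_upwards [hp α hα, hp β hβ, eventually_gt_atTop 0] with N ⟨ha0, ha1⟩ ⟨hb0, hb1⟩ hN k
    have hNk : (0 : ℝ) < (N : ℝ) ^ k := by positivity
    have h1 := binomCoeff_nonneg ha0 (m N - 1) k
    have h2 := binomCoeff_nonneg hb0 (N - m N) k
    have h3 : binomCoeff (1 - α / N) (m N - 1) k / (N : ℝ) ^ k ≤ 1 / k.factorial := by
      rw [div_le_iff₀ hNk, div_mul_eq_mul_div, one_mul]
      exact binomCoeff_le ha0 ha1 ((Nat.sub_le _ _).trans (hm N)) k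
    have h4 : binomCoeff (1 - β / N) (N - m N) k / (N : ℝ) ^ k ≤ 1 / k.factorial := by
      rw [div_le_iff₀ hNk, div_mul_eq_mul_div, one_mul]
      exact binomCoeff_le hb0 hb1 (Nat.sub_le _ _) k
    rw [Real.norm_of_nonneg (by positivity)]
    calc _ ≤ 1 / (k.factorial : ℝ) * (1 / k.factorial) * (α * β) ^ k := by gcongr
      _ = _ := by ring
end

section
/- Consider the decoder that, given the output Y, selects uniformly at random one of the codewords at minimum Hamming distance from Y, and declares the corresponding message; a decoding error is the event that the declared message differs from 0. The error probability equals 1 − 2^{N−NM} ∑_{τ=0}^{N} C(N,τ) p^τ (1−p)^{N−τ} ∑_{l=0}^{M−1} C(N,τ)^l · (1/(l+1)) · C(M−1, l) · (∑_{j=τ+1}^{N} C(N,j))^{M−1−l}. Equivalently, the probability of correct decoding is E[ 1{∀ i ≠ 0 : d_H(C_i,Y) ≥ d_H(C_0,Y)} / (1 + #{i ≠ 0 : d_H(C_i,Y) = d_H(C_0,Y)}) ], and it equals the displayed double sum. -/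
open scoped Classical
open Finset

/-- Hamming weight of a binary word. -/
def wt {N : ℕ} (z : Fin N → Bool) : ℕ :=
  (Finset.univ.filter fun n => z n = true).card

/-- Hamming distance between two binary words. -/
def dH {N : ℕ} (x y : Fin N → Bool) : ℕ :=
  (Finset.univ.filter fun n => x n ≠ y n).card

lemma sum_apply_wt {N : ℕ} (h : ℕ → ℝ) :
    ∑ z : Fin N → Bool, h (wt z) = ∑ j ∈ Finset.range (N + 1), (N.choose j : ℝ) * h j := by
  have e : ∑ z : Fin N → Bool, h (wt z) = ∑ s : Finset (Fin N), h s.card := by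
    refine Finset.sum_bij' (fun z _ => Finset.univ.filter fun n => z n = true)
      (fun s _ n => decide (n ∈ s)) ?_ ?_ ?_ ?_ ?_
    · simp
    · simp
    · intro z _
      ext n
      simp
    · intro s _
      ext n
      simp
    · intro z _
      rfl
  rw [e, ← Finset.powerset_univ, Finset.sum_powerset_apply_card]
  simp

lemma card_filter_wt_eq {N : ℕ} (τ : ℕ) (hτ : τ ≤ N) :
    ((Finset.univ.filter fun z : Fin N → Bool => wt z = τ).card : ℝ) = N.choose τ := by
  rw [← Finset.sum_boole, sum_apply_wt (fun j => if j = τ then 1 else 0)]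
  simp [Nat.lt_succ_of_le hτ]

lemma card_filter_lt_wt {N : ℕ} (τ : ℕ) :
    ((Finset.univ.filter fun z : Fin N → Bool => τ < wt z).card : ℝ) =
      ∑ j ∈ Finset.Icc (τ + 1) N, (N.choose j : ℝ) := by
  rw [← Finset.sum_boole, sum_apply_wt (fun j => if τ < j then 1 else 0)]
  simp only [mul_ite, mul_one, mul_zero, ← Finset.sum_filter]
  refine Finset.sum_congr ?_ fun _ _ => rfl
  ext j
  simp only [Finset.mem_filter, Finset.mem_range, Finset.mem_Icc]
  omega

/-- Sum over tuples all of whose values under `f` are at least `τ`, of a function of the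
number of coordinates at which the value `τ` is attained. -/
lemma sum_ite_forall_le_card {X : Type*} [Fintype X] (f : X → ℕ) (τ m : ℕ) (g : ℕ → ℝ) :
    (∑ u : Fin m → X, if ∀ i, τ ≤ f (u i) then
        g (Finset.univ.filter fun i => f (u i) = τ).card else 0) =
      ∑ l ∈ Finset.range (m + 1), (m.choose l : ℝ) *
        (((Finset.univ.filter fun x => f x = τ).card : ℝ) ^ l *
          ((Finset.univ.filter fun x => τ < f x).card : ℝ) ^ (m - l) * g l) := by
  induction m generalizing g with
  | zero => simp
  | succ m ih =>
    set A : ℝ := ((Finset.univ.filter fun x => f x = τ).card : ℝ) with hA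
    set B : ℝ := ((Finset.univ.filter fun x => τ < f x).card : ℝ) with hB
    have hsplit : ∀ (x : X) (u : Fin m → X),
        (if ∀ i, τ ≤ f ((Fin.cons x u : Fin (m + 1) → X) i) then
          g (Finset.univ.filter fun i => f ((Fin.cons x u : Fin (m + 1) → X) i) = τ).card
          else 0) =
        (if f x = τ then 1 else 0) * (if ∀ i, τ ≤ f (u i) then
          g ((Finset.univ.filter fun i => f (u i) = τ).card + 1) else 0) +
        (if τ < f x then 1 else 0) * (if ∀ i, τ ≤ f (u i) then
          g (Finset.univ.filter fun i => f (u i) = τ).card else 0) := by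
      intro x u
      rw [Fin.card_filter_univ_succ]
      simp only [Fin.forall_fin_succ, Fin.cons_zero, Fin.cons_succ]
      rcases lt_trichotomy (f x) τ with h | h | h
      · simp [h.ne, h.not_gt, h.not_ge]
      · simp [h]
      · simp [h.ne', h, h.le]
    rw [← (Fin.consEquiv fun _ : Fin (m + 1) => X).sum_comp, Fintype.sum_prod_type]
    simp only [Fin.consEquiv_apply, hsplit, Finset.sum_add_distrib, ← Finset.mul_sum,
      ← Finset.sum_mul, Finset.sum_boole]
    rw [ih g, ih (fun k => g (k + 1)),
      Finset.sum_choose_succ_mul (fun i j => A ^ i * B ^ j * g i) m, ← hA, ← hB, Finset.mul_sum,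
      Finset.mul_sum, add_comm]
    congr 1
    · refine Finset.sum_congr rfl fun l hl => ?_
      rw [Nat.succ_sub (Nat.lt_succ_iff.mp (Finset.mem_range.mp hl)), pow_succ]
      ring
    · refine Finset.sum_congr rfl fun l _ => ?_
      ring

lemma dH_eq_wt_xor {N : ℕ} (x y : Fin N → Bool) : dH x y = wt fun n => xor (x n) (y n) := by
  simp [dH, wt]

lemma dH_self_xor {N : ℕ} (x z : Fin N → Bool) : dH x (fun n => xor (x n) (z n)) = wt z := by
  simp [dH_eq_wt_xor]

/-- The distances of a tuple of words from `y` are the weights of a translated tuple. -/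
lemma sum_apply_dH {N m : ℕ} (y : Fin N → Bool) (F : (Fin m → ℕ) → ℝ) :
    (∑ c : Fin m → Fin N → Bool, F fun i => dH (c i) y) =
      ∑ u : Fin m → Fin N → Bool, F fun i => wt (u i) := by
  have hinv : Function.Involutive fun (c : Fin m → Fin N → Bool) i n => xor (c i n) (y n) := by
    intro c
    ext i n
    simp
  rw [← Equiv.sum_comp hinv.toPerm]
  simp [dH_eq_wt_xor, Function.Involutive.toPerm]

lemma sum_correct_given_noise {N m : ℕ} (z : Fin N → Bool) :
    (∑ cb : Fin (m + 1) → Fin N → Bool,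
      if ∀ i : Fin (m + 1), i ≠ 0 → dH (cb 0) (fun n => xor (cb 0 n) (z n)) ≤
          dH (cb i) (fun n => xor (cb 0 n) (z n))
        then (1 : ℝ) / (1 + ((Finset.univ.filter fun i : Fin (m + 1) =>
          i ≠ 0 ∧ dH (cb i) (fun n => xor (cb 0 n) (z n)) =
            dH (cb 0) (fun n => xor (cb 0 n) (z n))).card : ℝ))
        else 0) =
      2 ^ N * ∑ l ∈ Finset.range (m + 1), (N.choose (wt z) : ℝ) ^ l * (1 / ((l : ℝ) + 1)) *
        (m.choose l : ℝ) *
          (∑ j ∈ Finset.Icc (wt z + 1) N, (N.choose j : ℝ)) ^ (m - l) := by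
  have hz : wt z ≤ N := (Finset.card_le_univ _).trans_eq (Fintype.card_fin N)
  rw [← (Fin.consEquiv fun _ : Fin (m + 1) => Fin N → Bool).sum_comp, Fintype.sum_prod_type]
  simp only [Fin.consEquiv_apply, Fin.card_filter_univ_succ, Fin.forall_fin_succ, Fin.cons_zero,
    Fin.cons_succ, dH_self_xor, ne_eq, not_true_eq_false, false_imp_iff, true_and, false_and,
    if_false, Fin.succ_ne_zero, not_false_eq_true, true_imp_iff]
  have hc : ∀ x : Fin N → Bool,
      (∑ c : Fin m → Fin N → Bool, if ∀ i, wt z ≤ dH (c i) (fun n => xor (x n) (z n)) then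
        (1 : ℝ) / (1 + ((Finset.univ.filter fun i =>
          dH (c i) (fun n => xor (x n) (z n)) = wt z).card : ℝ)) else 0) =
      ∑ l ∈ Finset.range (m + 1), (N.choose (wt z) : ℝ) ^ l * (1 / ((l : ℝ) + 1)) *
        (m.choose l : ℝ) *
          (∑ j ∈ Finset.Icc (wt z + 1) N, (N.choose j : ℝ)) ^ (m - l) := by
    intro x
    rw [sum_apply_dH (fun n => xor (x n) (z n)) fun d => if ∀ i, wt z ≤ d i then
        (1 : ℝ) / (1 + ((Finset.univ.filter fun i => d i = wt z).card : ℝ)) else 0,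
      sum_ite_forall_le_card wt (wt z) m fun k => 1 / (1 + (k : ℝ)), card_filter_wt_eq _ hz,
      card_filter_lt_wt]
    refine Finset.sum_congr rfl fun l _ => ?_
    rw [add_comm (1 : ℝ)]
    ring
  refine (Finset.sum_congr rfl fun x _ => hc x).trans ?_
  simp

/-- Fano's expression with random tie-breaking, as modified by
Polyanskiy et al.: for random coding over BSC(p) with `M` independent uniform
codewords, message `0` sent and output `Y = C_0 ⊕ Z`, the probability of correct
decoding for the decoder that chooses uniformly among the codewords at minimum
distance from `Y`, namely
`E[ 1{∀ i ≠ 0 : d_H(C_i,Y) ≥ d_H(C_0,Y)} / (1 + #{i ≠ 0 : d_H(C_i,Y) = d_H(C_0,Y)}) ]`,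
equals
`2^{N−NM} ∑_{τ=0}^N C(N,τ) p^τ (1−p)^{N−τ}
  ∑_{l=0}^{M−1} C(N,τ)^l (1/(l+1)) C(M−1,l) (∑_{j=τ+1}^N C(N,j))^{M−1−l}`,
so the error probability equals one minus this quantity. -/
theorem stmt_16 (N M : ℕ) (hN : 1 ≤ N) (hM : 2 ≤ M) (p : ℝ)
    (hp : p ∈ Set.Ioo (0 : ℝ) 1) :
    (∑ cb : Fin M → Fin N → Bool, ∑ z : Fin N → Bool,
        (1 / 2 ^ (N * M) : ℝ) * p ^ wt z * (1 - p) ^ (N - wt z) *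
          (if ∀ i : Fin M, i ≠ ⟨0, by omega⟩ →
              dH (cb ⟨0, by omega⟩) (fun n => xor (cb ⟨0, by omega⟩ n) (z n)) ≤
                dH (cb i) (fun n => xor (cb ⟨0, by omega⟩ n) (z n))
            then (1 : ℝ) / (1 + ((Finset.univ.filter fun i : Fin M =>
                i ≠ ⟨0, by omega⟩ ∧
                  dH (cb i) (fun n => xor (cb ⟨0, by omega⟩ n) (z n)) =
                    dH (cb ⟨0, by omega⟩) (fun n => xor (cb ⟨0, by omega⟩ n) (z n))).card : ℝ))
            else 0))
      = (2 : ℝ) ^ ((N : ℤ) - (N : ℤ) * (M : ℤ)) *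
          ∑ τ ∈ Finset.range (N + 1), (N.choose τ : ℝ) * p ^ τ * (1 - p) ^ (N - τ) *
            ∑ l ∈ Finset.range M, (N.choose τ : ℝ) ^ l * (1 / ((l : ℝ) + 1)) *
              ((M - 1).choose l : ℝ) *
                (∑ j ∈ Finset.Icc (τ + 1) N, (N.choose j : ℝ)) ^ (M - 1 - l) := by
  obtain ⟨m, rfl⟩ : ∃ m, M = m + 1 := ⟨M - 1, by omega⟩
  rw [Finset.sum_comm]
  simp only [Nat.add_sub_cancel]
  refine (Finset.sum_congr rfl fun z _ => (Finset.mul_sum _ _ _).symm.trans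
    (congrArg _ (sum_correct_given_noise z))).trans ?_
  rw [sum_apply_wt fun τ => (1 / 2 ^ (N * (m + 1)) : ℝ) * p ^ τ * (1 - p) ^ (N - τ) *
    (2 ^ N * ∑ l ∈ Finset.range (m + 1), (N.choose τ : ℝ) ^ l * (1 / ((l : ℝ) + 1)) *
      (m.choose l : ℝ) * (∑ j ∈ Finset.Icc (τ + 1) N, (N.choose j : ℝ)) ^ (m - l)),
    zpow_sub₀ two_ne_zero, ← Nat.cast_mul, zpow_natCast, zpow_natCast, Finset.mul_sum]
  refine Finset.sum_congr rfl fun τ _ => ?_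
  ring
end
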